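/- For all integers n ≥ m ≥ 0, the inversion number and the major index are equidistributed on the set ℳ(m, n−m) of all (0,1)-sequences of length n with m ones and n−m zeros, and their common generating function is the Gaussian polynomial: Σ_{w ∈ ℳ(m,n−m)} q^{inv(w)} = Σ_{w ∈ ℳ(m,n−m)} q^{maj(w)} = [n m]_q. -/

import Mathlib

open Polynomial Finset

/-- The Gaussian polynomial `[n m]_q`, as a polynomial in `ℤ[q]`
(it vanishes when `m > n`).  It is defined by the `q`-Pascal recursion
`[n m]_q = [n-1 m-1]_q + q^m [n-1 m]_q`. -/
noncomputable def gauss : ℕ → ℕ → Polynomial ℤ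
  | _, 0 => 1
  | 0, _ + 1 => 0
  | n + 1, m + 1 => gauss n m + X ^ (m + 1) * gauss n (m + 1)

/-- The `q`-Kaplansky number `K_q(n,m) = ((1-q^(n+m))/(1-q^n))·[n m]_q`,
defined as the polynomial `[n-1 m-1]_q + q^m·[n m]_q`. -/
noncomputable def kap (n : ℕ) : ℕ → Polynomial ℤ
  | 0 => 1
  | m + 1 => gauss (n - 1) m + X ^ (m + 1) * gauss n (m + 1)

/-- The number of ones of a (0,1)-sequence. -/
def numOnes {N : ℕ} (w : Fin N → Bool) : ℕ :=
  (Finset.univ.filter fun i => w i = true).card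

/-- The inversion number of a (0,1)-sequence: the number of pairs `(i,j)`
with `i < j`, `w i = 1` and `w j = 0`. -/
def invW {N : ℕ} (w : Fin N → Bool) : ℕ :=
  ((Finset.univ : Finset (Fin N × Fin N)).filter
    fun p => p.1 < p.2 ∧ w p.1 = true ∧ w p.2 = false).card

/-- The major index of a (0,1)-sequence: the sum of the (1-based) positions `i`
with `w_i > w_(i+1)`. -/
def majW {N : ℕ} (w : Fin N → Bool) : ℕ :=
  ∑ i : Fin N,
    if h : (i : ℕ) + 1 < N then
      (if w i = true ∧ w ⟨(i : ℕ) + 1, h⟩ = false then (i : ℕ) + 1 else 0)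
    else 0

lemma gauss_zero_right (n : ℕ) : gauss n 0 = 1 := by cases n <;> simp [gauss]
lemma gauss_zero_succ (m : ℕ) : gauss 0 (m+1) = 0 := by simp [gauss]
lemma gauss_succ_succ (n m : ℕ) :
    gauss (n+1) (m+1) = gauss n m + X ^ (m + 1) * gauss n (m + 1) := by rw [gauss]

lemma gauss_pascal (n : ℕ) : ∀ m : ℕ,
    X ^ m * gauss (n+1) (m+1) = X ^ m * gauss n (m+1) + X ^ n * gauss n m := by
  induction n with
  | zero =>
    intro m
    rw [gauss_succ_succ]
    cases m <;> simp [gauss_zero_right, gauss_zero_succ]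
  | succ n ih =>
    intro m
    cases m with
    | zero =>
      have h := ih 0
      rw [gauss_succ_succ (n+1) 0]
      conv_rhs => rw [gauss_succ_succ n 0]
      simp only [gauss_zero_right] at *
      linear_combination X * h
    | succ m =>
      have h := ih m
      have h2 := ih (m+1)
      rw [gauss_succ_succ (n+1) (m+1)]
      conv_rhs => rw [gauss_succ_succ n (m+1), gauss_succ_succ n m]
      linear_combination X * h + X^(m+2) * h2

abbrev sn {n : ℕ} (v : Fin n → Bool) (b : Bool) : Fin (n+1) → Bool := Fin.snoc (α := fun _ => Bool) v b

lemma sum_sn {n : ℕ} (F : (Fin (n+1) → Bool) → Polynomial ℤ) :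
    ∑ w, F w = ∑ v : Fin n → Bool, F (sn v true) + ∑ v : Fin n → Bool, F (sn v false) := by
  rw [← (Fin.snocEquiv (fun _ : Fin (n+1) => Bool)).sum_comp, Fintype.sum_prod_type]
  simp [Fin.snocEquiv, sn]

lemma ones_sn {n : ℕ} (v : Fin n → Bool) (b : Bool) :
    numOnes (sn v b) = numOnes v + if b then 1 else 0 := by
  simp only [numOnes, Finset.card_filter, Fin.sum_univ_castSucc, sn, Fin.snoc_castSucc, Fin.snoc_last]

lemma inv_sn {n : ℕ} (v : Fin n → Bool) (b : Bool) :
    invW (sn v b) = invW v + if b then 0 else numOnes v := by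
  simp only [invW, numOnes, Finset.card_filter, Fintype.sum_prod_type, Fin.sum_univ_castSucc, sn,
    Fin.snoc_castSucc, Fin.snoc_last, Finset.sum_add_distrib]
  have h : ∀ x : Fin n, ¬ (Fin.last n < x.castSucc) := fun x => by simp [Fin.le_last]
  cases b <;> simp [Fin.castSucc_lt_last, h]

lemma maj_one (v : Fin 1 → Bool) : majW v = 0 := by simp [majW]

lemma maj_sn {n : ℕ} (v : Fin n → Bool) (a b : Bool) :
    majW (sn (sn v a) b) = majW (sn v a) + if a = true ∧ b = false then n + 1 else 0 := by
  have key : ∀ (m : ℕ) (u : Fin (m+1) → Bool), majW u =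
      ∑ i : Fin m, if u i.castSucc = true ∧ u i.succ = false then (i:ℕ) + 1 else 0 := by
    intro m u
    rw [majW, Fin.sum_univ_castSucc]
    simp only [Fin.val_last, lt_irrefl, dite_false, add_zero]
    apply Finset.sum_congr rfl
    intro i _
    rw [dif_pos (by simp)]
    rfl
  rw [key, key, Fin.sum_univ_castSucc]
  simp only [sn, Fin.snoc_castSucc, Fin.snoc_last, Fin.succ_last, Fin.succ_castSucc, Fin.val_castSucc, Fin.val_last]

lemma maj_sn_true {n : ℕ} (v : Fin n → Bool) : majW (sn v true) = majW v := by
  cases n with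
  | zero => rw [maj_one]; simp [majW]
  | succ n =>
    have : v = sn (Fin.init v) (v (Fin.last n)) := by simp [sn]
    rw [this, maj_sn]; simp

noncomputable def GI (n m : ℕ) : Polynomial ℤ :=
  ∑ w : Fin n → Bool, if numOnes w = m then X ^ invW w else 0
noncomputable def GM (n m : ℕ) : Polynomial ℤ :=
  ∑ w : Fin n → Bool, if numOnes w = m then X ^ majW w else 0
noncomputable def GZ (n m : ℕ) : Polynomial ℤ :=
  ∑ w : Fin n → Bool, if numOnes w = m then X ^ majW (sn w false) else 0

lemma GI_eq (n : ℕ) : ∀ m, GI n m = gauss n m := by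
  induction n with
  | zero =>
    intro m
    cases m <;> simp [GI, numOnes, invW, gauss]
  | succ n ih =>
    intro m
    rw [GI, sum_sn]
    simp only [ones_sn, inv_sn]
    have h2 : ∀ m, (∑ v : Fin n → Bool, if numOnes v = m then (X : Polynomial ℤ) ^ (invW v + numOnes v) else 0)
        = X ^ m * GI n m := by
      intro m
      rw [GI, Finset.mul_sum]
      refine Finset.sum_congr rfl fun v _ => ?_
      split_ifs with h
      · rw [h]; ring
      · simp
    cases m with
    | zero => simp [h2, ih, gauss_zero_right]
    | succ m =>
      simp [h2, ih, gauss_succ_succ]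
      rw [← ih, GI]

lemma GM_succ_zero (n : ℕ) : GM (n+1) 0 = GZ n 0 := by
  rw [GM, sum_sn]
  simp [ones_sn, GZ]

lemma GM_succ_succ (n m : ℕ) : GM (n+1) (m+1) = GM n m + GZ n (m+1) := by
  rw [GM, sum_sn]
  simp [ones_sn, GZ, GM, maj_sn_true]

lemma GZ_succ_zero (n : ℕ) : GZ (n+1) 0 = GZ n 0 := by
  rw [GZ, sum_sn]
  simp [ones_sn, GZ, maj_sn]

lemma GZ_succ_succ (n m : ℕ) : GZ (n+1) (m+1) = X ^ (n+1) * GM n m + GZ n (m+1) := by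
  rw [GZ, sum_sn]
  simp [ones_sn, GZ, GM, maj_sn, maj_sn_true, Finset.mul_sum, pow_add, mul_comm, mul_left_comm]

lemma GMZ_eq (n : ℕ) : ∀ m, GM n m = gauss n m ∧ GZ n m = X ^ m * gauss n m := by
  induction n with
  | zero =>
    intro m
    cases m <;> simp [GM, GZ, numOnes, maj_one, gauss, majW]
  | succ n ih =>
    intro m
    cases m with
    | zero => simp [GM_succ_zero, GZ_succ_zero, ih, gauss_zero_right]
    | succ m =>
      rw [GM_succ_succ, GZ_succ_succ, (ih m).1, (ih (m+1)).2]
      refine ⟨(gauss_succ_succ n m).symm, ?_⟩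
      linear_combination -X * gauss_pascal n m

/-- **MacMahon.** For `n ≥ m ≥ 0`, the inversion number and the
major index are equidistributed over the set `ℳ(m, n-m)` of (0,1)-sequences of
length `n` with `m` ones and `n-m` zeros, and their common generating function is
the Gaussian polynomial `[n m]_q`. -/
theorem macmahon_inv_maj (n m : ℕ) (hmn : m ≤ n) :
    (∑ w ∈ (Finset.univ : Finset (Fin n → Bool)).filter (fun w => numOnes w = m),
        (X : Polynomial ℤ) ^ invW w) =
      (∑ w ∈ (Finset.univ : Finset (Fin n → Bool)).filter (fun w => numOnes w = m),
        X ^ majW w) ∧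
    (∑ w ∈ (Finset.univ : Finset (Fin n → Bool)).filter (fun w => numOnes w = m),
        X ^ invW w) = gauss n m := by
  have h1 := GI_eq n m
  have h2 := (GMZ_eq n m).1
  rw [GI] at h1
  rw [GM] at h2
  simp only [Finset.sum_filter]
  exact ⟨h1.trans h2.symm, h1⟩
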